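/- arXiv:0808.2851 — 3 statements merged into one kernel-verified Lean document; each statement's English description precedes it below -/
import Mathlib

section
/- For every ν ≥ 1, every 1 ≤ p ≤ ∞, every 0 ≤ m < 4^ν and all complex scalars α_0, …, α_{4^ν−1}, one has ‖Σ_{j=0}^{m} α_j e^{(ν)}_j‖_{p,♯} ≤ 2 · ‖Σ_{j=0}^{4^ν−1} α_j e^{(ν)}_j‖_{p,♯}. (Lemma: the matrix units in shell enumeration form a basic sequence with constant 2 for the left norms.) -/
open Finset
open scoped ENNReal ComplexOrder Kronecker Matrix

noncomputable section

/-- Kronecker product of square complex matrices, realized on `Fin (m * n)`. -/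
def kron {m n : ℕ} (x : Matrix (Fin m) (Fin m) ℂ) (y : Matrix (Fin n) (Fin n) ℂ) :
    Matrix (Fin (m * n)) (Fin (m * n)) ℂ :=
  Matrix.reindex finProdFinEquiv finProdFinEquiv (x ⊗ₖ y)

/-- The matrix `A₁ = diag(α, 1 - α)`. -/
def A1 (α : ℝ) : Matrix (Fin 2) (Fin 2) ℂ :=
  Matrix.diagonal ![(α : ℂ), ((1 - α : ℝ) : ℂ)]

/-- The matrix `A₁^t = diag(α^t, (1 - α)^t)` (entrywise real power on the diagonal). -/
def A1t (α t : ℝ) : Matrix (Fin 2) (Fin 2) ℂ :=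
  Matrix.diagonal ![((α ^ t : ℝ) : ℂ), (((1 - α) ^ t : ℝ) : ℂ)]

/-- `Amat α ν = A_ν`, the ν-fold Kronecker power of `diag(α, 1-α)`. -/
def Amat (α : ℝ) : (ν : ℕ) → Matrix (Fin (2 ^ ν)) (Fin (2 ^ ν)) ℂ
  | 0 => 1
  | ν + 1 => kron (Amat α ν) (A1 α)

/-- `Amatt α t ν = A_ν^t`, the ν-fold Kronecker power of `diag(α^t, (1-α)^t)`. -/
def Amatt (α t : ℝ) : (ν : ℕ) → Matrix (Fin (2 ^ ν)) (Fin (2 ^ ν)) ℂ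
  | 0 => 1
  | ν + 1 => kron (Amatt α t ν) (A1t α t)

/-- The state `ρ_ν(x) = Tr (x A_ν)` on `N_ν = M_{2^ν}(ℂ)`. -/
def rho (α : ℝ) (ν : ℕ) (x : Matrix (Fin (2 ^ ν)) (Fin (2 ^ ν)) ℂ) : ℂ :=
  (x * Amat α ν).trace

/-- The state `ρ_1(x) = Tr (x A_1)` on `M_2(ℂ)`. -/
def rho1 (α : ℝ) (x : Matrix (Fin 2) (Fin 2) ℂ) : ℂ :=
  (x * A1 α).trace

/-- The Schatten `p`-norm `‖x‖_{C_p} = (Tr ((x^* x)^{p/2}))^{1/p}`, `1 ≤ p < ∞`,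
computed through the eigenvalues of the positive semidefinite matrix `x^* x`. -/
def schatten {N : ℕ} (p : ℝ) (x : Matrix (Fin N) (Fin N) ℂ) : ℝ :=
  (∑ i, ((Matrix.posSemidef_conjTranspose_mul_self x).isHermitian.eigenvalues i) ^ (p / 2)) ^
    (1 / p)

/-- The operator norm `‖x‖ = ‖x‖_{C_∞}` of a complex matrix (acting on ℓ²). -/
def opNorm {N : ℕ} (x : Matrix (Fin N) (Fin N) ℂ) : ℝ :=
  ‖Matrix.toEuclideanCLM (𝕜 := ℂ) x‖

/-- The left predual norm `‖x‖_♯ = ‖x A_ν‖_{C_1}` on `N_ν`. -/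
def sharpNorm (α : ℝ) {ν : ℕ} (x : Matrix (Fin (2 ^ ν)) (Fin (2 ^ ν)) ℂ) : ℝ :=
  schatten 1 (x * Amat α ν)

/-- The right predual norm `‖x‖_♭ = ‖A_ν x‖_{C_1}` on `N_ν`. -/
def flatNorm (α : ℝ) {ν : ℕ} (x : Matrix (Fin (2 ^ ν)) (Fin (2 ^ ν)) ℂ) : ℝ :=
  schatten 1 (Amat α ν * x)

/-- The left predual norm `‖x‖_♯ = ‖x A_1‖_{C_1}` on `M_2(ℂ)`. -/
def sharp2 (α : ℝ) (x : Matrix (Fin 2) (Fin 2) ℂ) : ℝ :=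
  schatten 1 (x * A1 α)

/-- The right predual norm `‖x‖_♭ = ‖A_1 x‖_{C_1}` on `M_2(ℂ)`. -/
def flat2 (α : ℝ) (x : Matrix (Fin 2) (Fin 2) ℂ) : ℝ :=
  schatten 1 (A1 α * x)

/-- The left norm `‖x‖_{p,♯} = ‖x A_ν^{1/p}‖_{C_p}` on `N_ν`, `1 ≤ p ≤ ∞`
(for `p = ∞` it is the operator norm). -/
def lpSharp (α : ℝ) (p : ℝ≥0∞) {ν : ℕ} (x : Matrix (Fin (2 ^ ν)) (Fin (2 ^ ν)) ℂ) : ℝ :=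
  if p = ∞ then opNorm x else schatten p.toReal (x * Amatt α (1 / p.toReal) ν)

/-- The right norm `‖x‖_{p,♭} = ‖A_ν^{1/p} x‖_{C_p}` on `N_ν`, `1 ≤ p ≤ ∞`. -/
def lpFlat (α : ℝ) (p : ℝ≥0∞) {ν : ℕ} (x : Matrix (Fin (2 ^ ν)) (Fin (2 ^ ν)) ℂ) : ℝ :=
  if p = ∞ then opNorm x else schatten p.toReal (Amatt α (1 / p.toReal) ν * x)

/-- The left norm `‖x‖_{p,♯} = ‖x A_1^{1/p}‖_{C_p}` on `M_2(ℂ)`. -/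
def lp2Sharp (α : ℝ) (p : ℝ≥0∞) (x : Matrix (Fin 2) (Fin 2) ℂ) : ℝ :=
  if p = ∞ then opNorm x else schatten p.toReal (x * A1t α (1 / p.toReal))

/-- `shellNum r c` is `s(r+1, c+1) - 1`, the zero-based shell enumeration index of the
matrix unit `E_{r c}` (zero-based indices `r`, `c`): `s(r,c) = (c-1)² + r` if `r ≤ c`
and `s(r,c) = r² - c + 1` if `r > c` (one-based). -/
def shellNum (r c : ℕ) : ℕ :=
  if r ≤ c then c * c + r else r * r + 2 * r - c

/-- `eUnit N m` is the `m`-th matrix unit `e_m` of `M_N(ℂ)` in the shell enumeration: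
`e_{s(r,c) - 1} = E_{r c}`. -/
def eUnit (N m : ℕ) : Matrix (Fin N) (Fin N) ℂ :=
  Matrix.of fun r c => if shellNum (r : ℕ) (c : ℕ) = m then 1 else 0

/-- The left Haar system `h^{(ν)}_j` in `N_ν` built from `r_0, r_1, r_2, r_3 ∈ M_2(ℂ)`:
`h^{(1)}_j = r_j`, and for `j = 4^ν q + k` (`0 ≤ q ≤ 3`, `0 ≤ k < 4^ν`),
`h^{(ν+1)}_j = h^{(ν)}_k ⊗ r_0` if `q = 0` and `h^{(ν+1)}_j = e^{(ν)}_k ⊗ r_q` if `q ≠ 0`. -/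
def haar (r : ℕ → Matrix (Fin 2) (Fin 2) ℂ) :
    (ν : ℕ) → ℕ → Matrix (Fin (2 ^ ν)) (Fin (2 ^ ν)) ℂ
  | 0, _ => 1
  | 1, j => r (j % 4)
  | ν + 2, j =>
      if j / 4 ^ (ν + 1) = 0 then kron (haar r (ν + 1) j) (r 0)
      else kron (eUnit (2 ^ (ν + 1)) (j % 4 ^ (ν + 1))) (r (j / 4 ^ (ν + 1) % 4))


section Helpers

open scoped Matrix.Norms.L2Operator

lemma aux_col_sum {N : ℕ} (A : Matrix (Fin N) (Fin N) ℂ) (hA : ‖A‖ ≤ 1) (i : Fin N) :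
    ∑ k, ‖A k i‖ ^ 2 ≤ 1 := by
  have h := Matrix.l2_opNorm_mulVec A (EuclideanSpace.single i (1 : ℂ))
  rw [PiLp.norm_single, norm_one, mul_one] at h
  have h2 := h.trans hA
  rw [EuclideanSpace.norm_eq] at h2
  rw [Real.sqrt_le_one] at h2
  have h3 := h2
  simpa using h3

lemma aux_row_sum {N : ℕ} (A : Matrix (Fin N) (Fin N) ℂ) (hA : ‖A‖ ≤ 1) (i : Fin N) :
    ∑ k, ‖A i k‖ ^ 2 ≤ 1 := by
  have h := aux_col_sum Aᴴ (by rwa [Matrix.l2_opNorm_conjTranspose]) i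
  simpa using h

lemma aux_jensen {ι : Type*} [Fintype ι] (w s : ι → ℝ) (hw : ∀ i, 0 ≤ w i) (hs : ∀ i, 0 ≤ s i)
    (hw1 : ∑ i, w i ≤ 1) {p : ℝ} (hp : 1 ≤ p) :
    (∑ i, w i * s i) ^ p ≤ ∑ i, w i * s i ^ p := by
  have h := Real.rpow_arith_mean_le_arith_mean_rpow (Finset.univ : Finset (Option ι))
    (fun o => o.elim (1 - ∑ i, w i) w) (fun o => o.elim 0 s)
    (by rintro (_ | i) _ <;> simp [hw, hw1]) (by simp)
    (by rintro (_ | i) _ <;> simp [hs]) hp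
  have hp0 : p ≠ 0 := by linarith
  simpa [Real.zero_rpow hp0] using h

lemma aux_svd {N : ℕ} (x : Matrix (Fin N) (Fin N) ℂ) :
    ∃ (U V : Matrix (Fin N) (Fin N) ℂ) (s : Fin N → ℝ), ‖U‖ ≤ 1 ∧ ‖V‖ ≤ 1 ∧ (∀ i, 0 ≤ s i) ∧
      x = Uᴴ * Matrix.diagonal (fun i => (s i : ℂ)) * Vᴴ ∧
      U * x * V = Matrix.diagonal (fun i => (s i : ℂ)) ∧
      ∀ p : ℝ, schatten p x = (∑ i, s i ^ p) ^ (1 / p) := by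
  have hps := Matrix.posSemidef_conjTranspose_mul_self x
  set hx := hps.isHermitian with hhx
  set W : Matrix (Fin N) (Fin N) ℂ := (hx.eigenvectorUnitary : Matrix (Fin N) (Fin N) ℂ) with hW
  have hW1 : Wᴴ * W = 1 := Unitary.coe_star_mul_self hx.eigenvectorUnitary
  have hW2 : W * Wᴴ = 1 := Unitary.coe_mul_star_self hx.eigenvectorUnitary
  set l := hx.eigenvalues with hl
  have hl0 : ∀ i, 0 ≤ l i := hps.eigenvalues_nonneg
  set s : Fin N → ℝ := fun i => Real.sqrt (l i) with hs
  have hss : ∀ i, (s i : ℂ) * (s i : ℂ) = (l i : ℂ) := by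
    intro i
    rw [← Complex.ofReal_mul, Real.mul_self_sqrt (hl0 i)]
  have hspec : xᴴ * x = W * Matrix.diagonal (fun i => (l i : ℂ)) * Wᴴ := by
    have := hx.spectral_theorem
    rw [Unitary.conjStarAlgAut_apply] at this
    exact this
  have hdiag : (x * W)ᴴ * (x * W) = Matrix.diagonal (fun i => (l i : ℂ)) := by
    calc (x * W)ᴴ * (x * W) = Wᴴ * (xᴴ * x) * W := by
          rw [Matrix.conjTranspose_mul]; simp only [Matrix.mul_assoc]
      _ = (Wᴴ * W) * Matrix.diagonal (fun i => (l i : ℂ)) * (Wᴴ * W) := by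
          rw [hspec]; simp only [Matrix.mul_assoc]
      _ = _ := by rw [hW1, Matrix.one_mul, Matrix.mul_one]
  set D : Matrix (Fin N) (Fin N) ℂ := Matrix.diagonal (fun i => ((s i)⁻¹ : ℂ)) with hD
  have hDH : Dᴴ = D := by
    rw [hD, Matrix.diagonal_conjTranspose]
    congr 1
    funext i
    simp
  set U := D * (x * W)ᴴ with hU
  have hUH : Uᴴ = (x * W) * D := by
    rw [hU, Matrix.conjTranspose_mul, hDH, Matrix.conjTranspose_conjTranspose]
  have hUx : U * x * W = Matrix.diagonal (fun i => (s i : ℂ)) := by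
    rw [hU, Matrix.mul_assoc, Matrix.mul_assoc, hdiag, hD, Matrix.diagonal_mul_diagonal]
    congr 1
    funext i
    rw [← hss i]
    by_cases h : (s i : ℂ) = 0
    · simp [h]
    · field_simp
  refine ⟨U, W, s, ?_, ?_, fun i => Real.sqrt_nonneg _, ?_, hUx, ?_⟩
  · have h1 : U * Uᴴ = Matrix.diagonal (fun i => ((s i : ℂ)⁻¹ * (s i : ℂ) * ((s i : ℂ) * (s i : ℂ)⁻¹))) := by
      rw [hUH, hU]
      calc D * (x * W)ᴴ * (x * W * D) = D * ((x * W)ᴴ * (x * W)) * D := by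
            simp only [Matrix.mul_assoc]
        _ = _ := by
            rw [hdiag, hD, Matrix.diagonal_mul_diagonal, Matrix.diagonal_mul_diagonal]
            congr 1
            funext i
            rw [← hss i]; ring
    have h2 : ‖U * Uᴴ‖ ≤ 1 := by
      rw [h1, Matrix.l2_opNorm_diagonal, pi_norm_le_iff_of_nonneg zero_le_one]
      intro i
      by_cases h : (s i : ℂ) = 0
      · simp [h]
      · rw [inv_mul_cancel₀ h, mul_inv_cancel₀ h]; simp
    have h3 := Matrix.l2_opNorm_conjTranspose_mul_self Uᴴ
    rw [Matrix.conjTranspose_conjTranspose, Matrix.l2_opNorm_conjTranspose] at h3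
    rw [h3] at h2
    nlinarith [norm_nonneg U]
  · have h3 := Matrix.l2_opNorm_conjTranspose_mul_self W
    rw [hW1] at h3
    have h1 : ‖(1 : Matrix (Fin N) (Fin N) ℂ)‖ ≤ 1 := by
      rw [← Matrix.diagonal_one, Matrix.l2_opNorm_diagonal, pi_norm_le_iff_of_nonneg zero_le_one]
      intro i; simp
    rw [h3] at h1
    nlinarith [norm_nonneg W]
  · have hcol : ∀ r i, s i = 0 → (x * W) r i = 0 := by
      intro r i hi
      have h4 := congrFun (congrFun hdiag i) i
      rw [Matrix.diagonal_apply_eq, ← hss i, hi, Matrix.mul_apply] at h4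
      have h5 : ∑ j, ‖(x * W) j i‖ ^ 2 = 0 := by
        have : ((∑ j, ‖(x * W) j i‖ ^ 2 : ℝ) : ℂ) = 0 := by
          rw [Complex.ofReal_sum]
          rw [show ((0 : ℝ) : ℂ) * ((0 : ℝ) : ℂ) = 0 by simp] at h4
          rw [← h4]
          refine Finset.sum_congr rfl fun j _ => ?_
          rw [Matrix.conjTranspose_apply]
          push_cast
          exact (Complex.conj_mul' _).symm
        exact_mod_cast this
      have h6 := (Finset.sum_eq_zero_iff_of_nonneg (fun j _ => by positivity)).mp h5 r
        (Finset.mem_univ r)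
      simpa using h6
    have h7 : x * W = Uᴴ * Matrix.diagonal (fun i => (s i : ℂ)) := by
      rw [hUH, Matrix.mul_assoc, hD, Matrix.diagonal_mul_diagonal]
      ext r i
      rw [Matrix.mul_diagonal]
      by_cases h : s i = 0
      · rw [hcol r i h, zero_mul]
      · have : (s i : ℂ) ≠ 0 := by exact_mod_cast h
        rw [inv_mul_cancel₀ this, mul_one]
    rw [← h7, Matrix.mul_assoc, hW2, Matrix.mul_one]
  · intro p
    unfold schatten
    congr 1
    refine Finset.sum_congr rfl fun i _ => ?_
    change l i ^ (p / 2) = _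
    simp only [hs]
    rw [Real.sqrt_eq_rpow, ← Real.rpow_mul (hl0 i)]
    congr 1
    ring

/-- Compressions by contractions: the `ℓ^p` norm of the diagonal is bounded by the Schatten norm. -/
lemma aux_diag_le {N : ℕ} (x A B : Matrix (Fin N) (Fin N) ℂ) (hA : ‖A‖ ≤ 1) (hB : ‖B‖ ≤ 1)
    {p : ℝ} (hp : 1 ≤ p) :
    (∑ i, ‖(A * x * B) i i‖ ^ p) ^ (1 / p) ≤ schatten p x := by
  obtain ⟨U, V, s, hU, hV, hs, hx, -, hsch⟩ := aux_svd x
  rw [hsch p]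
  have hp0 : 0 ≤ 1 / p := by positivity
  refine Real.rpow_le_rpow (Finset.sum_nonneg fun i _ => by positivity) ?_ hp0
  set C := A * Uᴴ with hC
  set E := Vᴴ * B with hE
  have hC1 : ‖C‖ ≤ 1 := by
    refine (Matrix.l2_opNorm_mul _ _).trans ?_
    rw [Matrix.l2_opNorm_conjTranspose]
    exact mul_le_one₀ hA (norm_nonneg _) hU
  have hE1 : ‖E‖ ≤ 1 := by
    refine (Matrix.l2_opNorm_mul _ _).trans ?_
    rw [Matrix.l2_opNorm_conjTranspose]
    exact mul_le_one₀ hV (norm_nonneg _) hB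
  have hAB : A * x * B = C * Matrix.diagonal (fun i => (s i : ℂ)) * E := by
    rw [hx, hC, hE]; simp only [Matrix.mul_assoc]
  set w : Fin N → Fin N → ℝ := fun i k => (‖C i k‖ ^ 2 + ‖E k i‖ ^ 2) / 2 with hw
  have hw0 : ∀ i k, 0 ≤ w i k := fun i k => by positivity
  have hwr : ∀ i, ∑ k, w i k ≤ 1 := by
    intro i
    simp only [hw]
    rw [← Finset.sum_div, Finset.sum_add_distrib]
    linarith [aux_row_sum C hC1 i, aux_col_sum E hE1 i]
  have hwc : ∀ k, ∑ i, w i k ≤ 1 := by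
    intro k
    simp only [hw]
    rw [← Finset.sum_div, Finset.sum_add_distrib]
    linarith [aux_col_sum C hC1 k, aux_row_sum E hE1 k]
  calc ∑ i, ‖(A * x * B) i i‖ ^ p ≤ ∑ i, ∑ k, w i k * s k ^ p := by
        refine Finset.sum_le_sum fun i _ => ?_
        refine le_trans (Real.rpow_le_rpow (norm_nonneg _) ?_ (by linarith))
          (aux_jensen (w i) s (hw0 i) hs (hwr i) hp)
        rw [hAB, Matrix.mul_apply]
        refine (norm_sum_le _ _).trans (Finset.sum_le_sum fun k _ => ?_)
        rw [Matrix.mul_diagonal, norm_mul, norm_mul, Complex.norm_real, Real.norm_of_nonneg (hs k)]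
        have := two_mul_le_add_sq ‖C i k‖ ‖E k i‖
        have h2 : ‖C i k‖ * ‖E k i‖ ≤ w i k := by simp only [hw]; linarith
        calc _ = ‖C i k‖ * ‖E k i‖ * s k := by ring
          _ ≤ _ := mul_le_mul_of_nonneg_right h2 (hs k)
    _ = ∑ k, (∑ i, w i k) * s k ^ p := by
        rw [Finset.sum_comm]
        simp only [Finset.sum_mul]
    _ ≤ ∑ k, s k ^ p := by
        refine Finset.sum_le_sum fun k _ => ?_
        exact mul_le_of_le_one_left (Real.rpow_nonneg (hs k) p) (hwc k)

lemma aux_schatten_two {N : ℕ} (x P Q P' Q' : Matrix (Fin N) (Fin N) ℂ) (hP : ‖P‖ ≤ 1)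
    (hQ : ‖Q‖ ≤ 1) (hP' : ‖P'‖ ≤ 1) (hQ' : ‖Q'‖ ≤ 1) {p : ℝ} (hp : 1 ≤ p) :
    schatten p (P * x * Q + P' * x * Q') ≤ 2 * schatten p x := by
  obtain ⟨U, V, s, hU, hV, hs, -, hd, hsch⟩ := aux_svd (P * x * Q + P' * x * Q')
  have hm : ∀ A B : Matrix (Fin N) (Fin N) ℂ, ‖A‖ ≤ 1 → ‖B‖ ≤ 1 → ‖A * B‖ ≤ 1 := fun A B hA hB =>
    (Matrix.l2_opNorm_mul _ _).trans (mul_le_one₀ hA (norm_nonneg _) hB)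
  have h1 := aux_diag_le x (U * P) (Q * V) (hm _ _ hU hP) (hm _ _ hQ hV) hp
  have h2 := aux_diag_le x (U * P') (Q' * V) (hm _ _ hU hP') (hm _ _ hQ' hV) hp
  have h3 := Real.Lp_add_le_of_nonneg (Finset.univ : Finset (Fin N))
    (f := fun i => ‖(U * P * x * (Q * V)) i i‖) (g := fun i => ‖(U * P' * x * (Q' * V)) i i‖) hp
    (fun i _ => norm_nonneg _) (fun i _ => norm_nonneg _)
  rw [hsch p, two_mul]
  refine le_trans ?_ (h3.trans (add_le_add h1 h2))
  have hp0 : 0 ≤ 1 / p := by positivity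
  refine Real.rpow_le_rpow (Finset.sum_nonneg fun i _ => Real.rpow_nonneg (hs i) p) ?_ hp0
  refine Finset.sum_le_sum fun i _ => Real.rpow_le_rpow (hs i) ?_ (by linarith)
  have h4 := congrFun (congrFun hd i) i
  rw [Matrix.diagonal_apply_eq] at h4
  have h5 : U * (P * x * Q + P' * x * Q') * V
      = U * P * x * (Q * V) + U * P' * x * (Q' * V) := by
    simp only [Matrix.mul_add, Matrix.add_mul, Matrix.mul_assoc]
  rw [h5, Matrix.add_apply] at h4
  calc s i = ‖(s i : ℂ)‖ := by rw [Complex.norm_real, Real.norm_of_nonneg (hs i)]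
    _ ≤ _ := by rw [← h4]; exact norm_add_le _ _

lemma aux_opNorm_two {N : ℕ} (x P Q P' Q' : Matrix (Fin N) (Fin N) ℂ) (hP : ‖P‖ ≤ 1)
    (hQ : ‖Q‖ ≤ 1) (hP' : ‖P'‖ ≤ 1) (hQ' : ‖Q'‖ ≤ 1) :
    opNorm (P * x * Q + P' * x * Q') ≤ 2 * opNorm x := by
  change ‖P * x * Q + P' * x * Q'‖ ≤ 2 * ‖x‖
  have hm : ∀ A B : Matrix (Fin N) (Fin N) ℂ, ‖A‖ ≤ 1 → ‖B‖ ≤ 1 → ‖A * x * B‖ ≤ ‖x‖ := by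
    intro A B hA hB
    calc ‖A * x * B‖ ≤ ‖A * x‖ * ‖B‖ := Matrix.l2_opNorm_mul _ _
      _ ≤ (‖A‖ * ‖x‖) * ‖B‖ := by gcongr; exact Matrix.l2_opNorm_mul _ _
      _ ≤ (1 * ‖x‖) * 1 := by gcongr
      _ = ‖x‖ := by ring
  linarith [norm_add_le (P * x * Q) (P' * x * Q'), hm P Q hP hQ, hm P' Q' hP' hQ']

lemma aux_Amatt_diag (α t : ℝ) (ν : ℕ) :
    ∃ d : Fin (2 ^ ν) → ℂ, Amatt α t ν = Matrix.diagonal d := by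
  induction ν with
  | zero => exact ⟨1, by simp [Amatt]⟩
  | succ n ih =>
    obtain ⟨d, hd⟩ := ih
    have h := Matrix.diagonal_kronecker_diagonal d ![((α ^ t : ℝ) : ℂ), (((1 - α) ^ t : ℝ) : ℂ)]
    have h2 : Amatt α t (n + 1) = Matrix.reindex finProdFinEquiv finProdFinEquiv
        (Matrix.diagonal d ⊗ₖ Matrix.diagonal ![((α ^ t : ℝ) : ℂ), (((1 - α) ^ t : ℝ) : ℂ)]) := by
      rw [Amatt, hd, kron, A1t]
    rw [h, Matrix.reindex_apply, Matrix.submatrix_diagonal_equiv] at h2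
    exact ⟨_, h2⟩

/-- Diagonal projection onto the indices satisfying `S`. -/
def auxProj (N : ℕ) (S : ℕ → Prop) [DecidablePred S] : Matrix (Fin N) (Fin N) ℂ :=
  Matrix.diagonal fun i => if S i then 1 else 0

lemma aux_proj_norm (N : ℕ) (S : ℕ → Prop) [DecidablePred S] : ‖auxProj N S‖ ≤ 1 := by
  rw [auxProj, Matrix.l2_opNorm_diagonal, pi_norm_le_iff_of_nonneg zero_le_one]
  intro i
  split_ifs <;> simp

lemma aux_partial_apply (N M : ℕ) (a : ℕ → ℂ) (r c : Fin N) :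
    (∑ j ∈ Finset.range M, a j • eUnit N j) r c
      = if shellNum r c < M then a (shellNum r c) else 0 := by
  rw [Matrix.sum_apply]
  simp [eUnit]

lemma aux_shell_lt {N r c : ℕ} (hr : r < N) (hc : c < N) : shellNum r c < N * N := by
  unfold shellNum
  split_ifs with h
  · nlinarith
  · have : r * r + 2 * r < N * N := by nlinarith
    omega

lemma aux_shell_split (m : ℕ) : ∃ R C R' C' : ℕ → Prop, ∀ r c : ℕ,
    (shellNum r c < m + 1 ↔ (R r ∧ C c) ∨ (R' r ∧ C' c)) ∧ ¬ ((R r ∧ C c) ∧ (R' r ∧ C' c)) := by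
  obtain ⟨k, j, hj, rfl⟩ : ∃ k j, j ≤ 2 * k ∧ m = k * k + j := by
    refine ⟨Nat.sqrt m, m - Nat.sqrt m * Nat.sqrt m, ?_, ?_⟩
    · have := Nat.sqrt_le_add m; omega
    · have := Nat.sqrt_le m; omega
  by_cases hjk : j ≤ k
  · refine ⟨fun r => r < k, fun c => c < k, fun r => r ≤ j, fun c => c = k, fun r c => ⟨?_, ?_⟩⟩
    · unfold shellNum
      split_ifs with h
      · rcases lt_trichotomy c k with h1 | h1 | h1
        · have : c * c + r < k * k + j + 1 := by nlinarith
          simp only [this, true_iff]; omega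
        · subst h1; omega
        · have : ¬ (c * c + r < k * k + j + 1) := by nlinarith
          simp only [this, false_iff]; omega
      · rcases lt_or_ge r k with h1 | h1
        · have : r * r + 2 * r < k * k := by nlinarith
          omega
        · have : k * k + 2 * k ≤ r * r + 2 * r := by nlinarith
          have : k * k + k * 1 + r ≤ r * r + 2 * r := by nlinarith
          omega
    · omega
  · refine ⟨fun r => r < k, fun c => c < k + 1, fun r => r = k,
      fun c => 2 * k ≤ c + j ∧ c ≤ k, fun r c => ⟨?_, ?_⟩⟩
    · unfold shellNum
      split_ifs with h
      · rcases lt_trichotomy c k with h1 | h1 | h1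
        · have : c * c + r < k * k + j + 1 := by nlinarith
          simp only [this, true_iff]; omega
        · subst h1; omega
        · have : ¬ (c * c + r < k * k + j + 1) := by nlinarith
          simp only [this, false_iff]; omega
      · rcases lt_trichotomy r k with h1 | h1 | h1
        · have : r * r + 2 * r < k * k := by nlinarith
          omega
        · subst h1; omega
        · have : k * k + 2 * k + 1 + r ≤ r * r + 2 * r := by nlinarith
          omega
    · omega

open Classical in
lemma aux_partial_eq (ν m : ℕ) (a : ℕ → ℂ) : ∃ R C R' C' : ℕ → Prop,
    (∑ j ∈ Finset.range (m + 1), a j • eUnit (2 ^ ν) j) =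
      auxProj (2 ^ ν) R * (∑ j ∈ Finset.range (4 ^ ν), a j • eUnit (2 ^ ν) j) * auxProj (2 ^ ν) C
      + auxProj (2 ^ ν) R' * (∑ j ∈ Finset.range (4 ^ ν), a j • eUnit (2 ^ ν) j)
        * auxProj (2 ^ ν) C' := by
  obtain ⟨R, C, R', C', h⟩ := aux_shell_split m
  refine ⟨R, C, R', C', ?_⟩
  ext r c
  have h4 : 4 ^ ν = 2 ^ ν * 2 ^ ν := by rw [← mul_pow]; norm_num
  have hlt : shellNum r c < 4 ^ ν := by rw [h4]; exact aux_shell_lt r.2 c.2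
  rw [Matrix.add_apply]
  simp only [auxProj, Matrix.mul_diagonal, Matrix.diagonal_mul]
  rw [aux_partial_apply, aux_partial_apply, if_pos hlt]
  obtain ⟨h1, h2⟩ := h r c
  by_cases hR : R r <;> by_cases hC : C c <;> by_cases hR' : R' r <;> by_cases hC' : C' c <;>
    simp_all

end Helpers

/-- the matrix units in shell enumeration form a basic sequence with
constant 2 for the left norms `‖·‖_{p,♯}`, `1 ≤ p ≤ ∞`. -/
theorem matrixUnits_basic_sequence_sharp
    (α : ℝ) (hα0 : 0 < α) (hα : α ≤ 1 / 2)
    (ν : ℕ) (hν : 1 ≤ ν) (p : ℝ≥0∞) (hp : 1 ≤ p)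
    (m : ℕ) (hm : m < 4 ^ ν) (a : ℕ → ℂ) :
    lpSharp α p (∑ j ∈ Finset.range (m + 1), a j • eUnit (2 ^ ν) j) ≤
      2 * lpSharp α p (∑ j ∈ Finset.range (4 ^ ν), a j • eUnit (2 ^ ν) j) := by
  classical
  obtain ⟨R, C, R', C', h⟩ := aux_partial_eq ν m a
  rw [h]
  generalize (∑ j ∈ Finset.range (4 ^ ν), a j • eUnit (2 ^ ν) j) = X
  unfold lpSharp
  split_ifs with hp'
  · exact aux_opNorm_two _ _ _ _ _ (aux_proj_norm _ _) (aux_proj_norm _ _) (aux_proj_norm _ _)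
      (aux_proj_norm _ _)
  · have hp1 : 1 ≤ p.toReal := by
      have := ENNReal.toReal_mono hp' hp
      simpa using this
    obtain ⟨d, hd⟩ := aux_Amatt_diag α (1 / p.toReal) ν
    have hcomm : ∀ S : ℕ → Prop, auxProj (2 ^ ν) S * Amatt α (1 / p.toReal) ν
        = Amatt α (1 / p.toReal) ν * auxProj (2 ^ ν) S := by
      intro S
      rw [hd, auxProj, Matrix.diagonal_mul_diagonal, Matrix.diagonal_mul_diagonal]
      congr 1
      funext i
      exact mul_comm _ _
    have key := aux_schatten_two (X * Amatt α (1 / p.toReal) ν) _ _ _ _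
      (aux_proj_norm (2 ^ ν) R) (aux_proj_norm (2 ^ ν) C) (aux_proj_norm (2 ^ ν) R')
      (aux_proj_norm (2 ^ ν) C') hp1
    convert key using 2
    rw [Matrix.add_mul]
    simp only [Matrix.mul_assoc, hcomm]

end
end

section
/- Let r_0, r_1, r_2, r_3 ∈ M_2(ℂ) satisfy ρ_1(r_j* r_k) = δ_{jk} for 0 ≤ j, k ≤ 3. Then for every 0 ≤ m ≤ 3 and all complex scalars α_0, …, α_3, ‖Σ_{j=0}^{m} α_j r_j‖_♯ ≤ (Σ_{j=0}^{3} ‖r_j‖ · ‖r_j‖_♯) · ‖Σ_{j=0}^{3} α_j r_j‖_♯. (First estimate of Theorem 1: the basis constant c_{1,♯} of the Haar system at level 1 is at most Σ_j ‖r_j‖ ‖r_j‖_♯.) -/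
open Finset
open scoped ENNReal ComplexOrder Kronecker Matrix

noncomputable section

lemma schatten_one_eq {N : ℕ} (x : Matrix (Fin N) (Fin N) ℂ) :
    schatten 1 x = ∑ i, √((Matrix.posSemidef_conjTranspose_mul_self x).isHermitian.eigenvalues i) := by
  simp [schatten, Real.sqrt_eq_rpow]

lemma schatten_one_nonneg {N : ℕ} (x : Matrix (Fin N) (Fin N) ℂ) : 0 ≤ schatten 1 x := by
  rw [schatten_one_eq]
  exact Finset.sum_nonneg fun i _ => Real.sqrt_nonneg _

lemma opNorm_conjTranspose {N : ℕ} (x : Matrix (Fin N) (Fin N) ℂ) :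
    opNorm xᴴ = opNorm x := by
  unfold opNorm
  rw [← Matrix.star_eq_conjTranspose, map_star, ContinuousLinearMap.star_eq_adjoint]
  exact LinearIsometryEquiv.norm_map _ _

lemma trace_eq_sum_inner_basis {N : ℕ} (y : Matrix (Fin N) (Fin N) ℂ)
    (b : OrthonormalBasis (Fin N) ℂ (EuclideanSpace ℂ (Fin N))) :
    y.trace = ∑ i, inner ℂ (b i) (Matrix.toEuclideanCLM (𝕜 := ℂ) y (b i)) := by
  have h := LinearMap.trace_eq_sum_inner (Matrix.toLpLin 2 2 y) b
  rw [Matrix.toLpLin_eq_toLin, Matrix.trace_toLin_eq] at h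
  rw [h, ← Matrix.toLpLin_eq_toLin]
  rfl

lemma norm_sq_eigenvector {N : ℕ} (x : Matrix (Fin N) (Fin N) ℂ) (hx : (xᴴ * x).IsHermitian)
    (i : Fin N) :
    ‖Matrix.toEuclideanCLM (𝕜 := ℂ) x (hx.eigenvectorBasis i)‖ ^ 2 = hx.eigenvalues i := by
  have h3 : Matrix.toEuclideanCLM (𝕜 := ℂ) (xᴴ * x) (hx.eigenvectorBasis i) =
      ((hx.eigenvalues i : ℝ) : ℂ) • hx.eigenvectorBasis i := by
    ext k
    have := congrFun (hx.mulVec_eigenvectorBasis i) k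
    rw [Matrix.ofLp_toEuclideanCLM, this]
    simp
  have h2 : inner ℂ (hx.eigenvectorBasis i)
      (Matrix.toEuclideanCLM (𝕜 := ℂ) (xᴴ * x) (hx.eigenvectorBasis i)) =
      ((hx.eigenvalues i : ℝ) : ℂ) := by
    rw [h3, inner_smul_right, inner_self_eq_norm_sq_to_K, hx.eigenvectorBasis.norm_eq_one]
    simp
  have h5 : Matrix.toEuclideanCLM (𝕜 := ℂ) xᴴ =
      ContinuousLinearMap.adjoint (Matrix.toEuclideanCLM (𝕜 := ℂ) x) := by
    rw [← Matrix.star_eq_conjTranspose, map_star, ContinuousLinearMap.star_eq_adjoint]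
  rw [map_mul, h5, ContinuousLinearMap.mul_apply, ContinuousLinearMap.adjoint_inner_right,
    inner_self_eq_norm_sq_to_K] at h2
  have h4 := congrArg Complex.re h2
  rw [Complex.ofReal_re] at h4
  rw [← h4, ← Complex.ofReal_re (‖_‖ ^ 2), Complex.ofReal_pow]
  rfl

/-- Trace duality between the trace norm and the operator norm. -/
lemma norm_trace_mul_le {N : ℕ} (y x : Matrix (Fin N) (Fin N) ℂ) :
    ‖(y * x).trace‖ ≤ opNorm y * schatten 1 x := by
  rw [schatten_one_eq]
  generalize (Matrix.posSemidef_conjTranspose_mul_self x).isHermitian = hx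
  rw [trace_eq_sum_inner_basis _ hx.eigenvectorBasis, Finset.mul_sum]
  refine (norm_sum_le _ _).trans (Finset.sum_le_sum fun i _ => ?_)
  refine (norm_inner_le_norm _ _).trans ?_
  rw [hx.eigenvectorBasis.norm_eq_one, one_mul, map_mul, ← norm_sq_eigenvector x hx i,
    Real.sqrt_sq (norm_nonneg _)]
  exact ContinuousLinearMap.le_opNorm (Matrix.toEuclideanCLM (𝕜 := ℂ) y) _

lemma schatten_one_sq (x : Matrix (Fin 2) (Fin 2) ℂ) :
    (((schatten 1 x) ^ 2 : ℝ) : ℂ) = (xᴴ * x).trace + 2 * ((‖x.det‖ : ℝ) : ℂ) := by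
  have hp := Matrix.posSemidef_conjTranspose_mul_self x
  have htr := hp.isHermitian.trace_eq_sum_eigenvalues
  have hdet := hp.isHermitian.det_eq_prod_eigenvalues
  rw [schatten_one_eq, htr]
  have h0 := hp.eigenvalues_nonneg 0
  have h1 := hp.eigenvalues_nonneg 1
  simp only [Fin.sum_univ_two, Fin.prod_univ_two] at *
  set l0 := hp.isHermitian.eigenvalues 0
  set l1 := hp.isHermitian.eigenvalues 1
  have hd : ‖x.det‖ ^ 2 = l0 * l1 := by
    rw [Matrix.det_mul, Matrix.det_conjTranspose] at hdet
    have : ((‖x.det‖ ^ 2 : ℝ) : ℂ) = ((l0 * l1 : ℝ) : ℂ) := by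
      push_cast
      rw [← Complex.conj_mul']
      exact hdet
    exact_mod_cast this
  have hd' : ‖x.det‖ = √l0 * √l1 := by
    rw [← Real.sqrt_mul h0, ← hd, Real.sqrt_sq (norm_nonneg _)]
  rw [hd']
  have : (√l0 + √l1) ^ 2 = l0 + l1 + 2 * (√l0 * √l1) := by
    rw [add_sq, Real.sq_sqrt h0, Real.sq_sqrt h1]; ring
  rw [this]
  push_cast
  rfl

/-- The trace norm of a `2 × 2` matrix is attained by a contraction. -/
lemma exists_contraction (x : Matrix (Fin 2) (Fin 2) ℂ) :
    ∃ u : Matrix (Fin 2) (Fin 2) ℂ, opNorm u ≤ 1 ∧ (u * x).trace = ((schatten 1 x : ℝ) : ℂ) := by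
  by_cases hs : schatten 1 x = 0
  · exact ⟨0, by simp [opNorm], by simp [hs]⟩
  obtain ⟨w, hw, hwd⟩ : ∃ w : ℂ, star w * w = 1 ∧ star w * x.det = ((‖x.det‖ : ℝ) : ℂ) := by
    by_cases hd : x.det = 0
    · exact ⟨1, by simp, by simp [hd]⟩
    · have hn : ((‖x.det‖ : ℝ) : ℂ) ≠ 0 := by simpa using hd
      have hc : star x.det * x.det = ((‖x.det‖ : ℝ) : ℂ) ^ 2 := Complex.conj_mul' _
      have hst : star ((‖x.det‖ : ℝ) : ℂ) = ((‖x.det‖ : ℝ) : ℂ) := Complex.conj_ofReal _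
      refine ⟨x.det / ((‖x.det‖ : ℝ) : ℂ), ?_, ?_⟩
      · rw [star_div₀, hst]; field_simp; exact hc
      · rw [star_div₀, hst]; field_simp; exact hc
  have hsq := schatten_one_sq x
  set s := schatten 1 x
  have hsC : (s : ℂ) ≠ 0 := by exact_mod_cast hs
  have hdw : x.det = w * ((‖x.det‖ : ℝ) : ℂ) := by
    rw [← hwd, ← mul_assoc, mul_comm w, hw, one_mul]
  have hdw' : w * star x.det = ((‖x.det‖ : ℝ) : ℂ) := by
    have h := congrArg star hdw
    rw [star_mul'] at h
    rw [h, ← mul_assoc, mul_comm w, hw, one_mul]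
    have : star ((‖x.det‖ : ℝ) : ℂ) = ((‖x.det‖ : ℝ) : ℂ) := Complex.conj_ofReal _
    exact this
  set d : ℂ := ((‖x.det‖ : ℝ) : ℂ)
  -- `z` is `s` times the adjoint of a unitary
  set z : Matrix (Fin 2) (Fin 2) ℂ := xᴴ + star w • x.adjugate with hz
  have hzz : zᴴ * z = ((s : ℂ) ^ 2) • (1 : Matrix (Fin 2) (Fin 2) ℂ) := by
    push_cast at hsq
    rw [hsq, hz]
    simp only [Matrix.det_fin_two, Matrix.trace_fin_two, Matrix.mul_apply, Fin.sum_univ_two,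
      Matrix.conjTranspose_apply, star_sub, star_mul'] at *
    ext i j
    fin_cases i <;> fin_cases j <;>
      simp [Matrix.mul_apply, Matrix.adjugate_fin_two, Fin.sum_univ_two] at *
    · linear_combination (x 1 1 * starRingEnd ℂ (x 1 1) + x 1 0 * starRingEnd ℂ (x 1 0)) * hw + hdw' + hwd
    · linear_combination (-(x 0 0 * starRingEnd ℂ (x 1 0) + x 0 1 * starRingEnd ℂ (x 1 1))) * hw
    · linear_combination (-(x 1 0 * starRingEnd ℂ (x 0 0) + x 1 1 * starRingEnd ℂ (x 0 1))) * hw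
    · linear_combination (x 0 0 * starRingEnd ℂ (x 0 0) + x 0 1 * starRingEnd ℂ (x 0 1)) * hw + hdw' + hwd
  have hzx : (z * x).trace = (s : ℂ) ^ 2 := by
    push_cast at hsq
    rw [hsq, hz, add_mul, Matrix.trace_add, Matrix.smul_mul, Matrix.adjugate_mul,
      Matrix.trace_smul, Matrix.trace_smul, Matrix.trace_one]
    simp only [smul_eq_mul, ← hwd]
    simp
    ring
  refine ⟨(s : ℂ)⁻¹ • z, ?_, ?_⟩
  · have h1 : star ((s : ℂ)⁻¹ • z) * ((s : ℂ)⁻¹ • z) = 1 := by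
      rw [star_smul, Matrix.star_eq_conjTranspose, Matrix.smul_mul, Matrix.mul_smul, hzz, smul_smul,
        smul_smul]
      have : star ((s : ℂ)⁻¹) = (s : ℂ)⁻¹ := by
        rw [star_inv₀]; congr 1; exact Complex.conj_ofReal _
      rw [this]
      have : (s : ℂ)⁻¹ * (s : ℂ)⁻¹ * (s : ℂ) ^ 2 = 1 := by field_simp
      rw [this, one_smul]
    have h2 := CStarRing.norm_star_mul_self (x := Matrix.toEuclideanCLM (𝕜 := ℂ) ((s : ℂ)⁻¹ • z))
    rw [← map_star, ← map_mul, h1, map_one, norm_one] at h2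
    unfold opNorm
    nlinarith [norm_nonneg (Matrix.toEuclideanCLM (𝕜 := ℂ) ((s : ℂ)⁻¹ • z))]
  · rw [Matrix.smul_mul, Matrix.trace_smul, hzx, smul_eq_mul]
    field_simp

lemma schatten_one_sum_le (S : Finset ℕ) (a : ℕ → ℂ) (x : ℕ → Matrix (Fin 2) (Fin 2) ℂ) :
    schatten 1 (∑ j ∈ S, a j • x j) ≤ ∑ j ∈ S, ‖a j‖ * schatten 1 (x j) := by
  obtain ⟨u, hu, hux⟩ := exists_contraction (∑ j ∈ S, a j • x j)
  have h : schatten 1 (∑ j ∈ S, a j • x j) = ‖(u * ∑ j ∈ S, a j • x j).trace‖ := by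
    rw [hux, Complex.norm_real, Real.norm_of_nonneg (schatten_one_nonneg _)]
  rw [h, Finset.mul_sum, Matrix.trace_sum]
  refine (norm_sum_le _ _).trans (Finset.sum_le_sum fun j _ => ?_)
  rw [Matrix.mul_smul, Matrix.trace_smul, norm_smul]
  refine mul_le_mul_of_nonneg_left ?_ (norm_nonneg _)
  refine (norm_trace_mul_le u (x j)).trans ?_
  exact mul_le_of_le_one_left (schatten_one_nonneg _) hu

/-- level-one estimate of Theorem 1, `c_{1,♯} ≤ Σ_j ‖r_j‖ ‖r_j‖_♯`. -/
theorem haar_level_one_basis_constant_sharp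
    (α : ℝ) (hα0 : 0 < α) (hα : α ≤ 1 / 2)
    (r : ℕ → Matrix (Fin 2) (Fin 2) ℂ)
    (hr : ∀ j < 4, ∀ k < 4, rho1 α ((r j)ᴴ * r k) = if j = k then 1 else 0)
    (m : ℕ) (hm : m ≤ 3) (a : ℕ → ℂ) :
    sharp2 α (∑ j ∈ Finset.range (m + 1), a j • r j) ≤
      (∑ j ∈ Finset.range 4, opNorm (r j) * sharp2 α (r j)) *
        sharp2 α (∑ j ∈ Finset.range 4, a j • r j) := by
  have hcoef : ∀ j < 4, ‖a j‖ ≤ opNorm (r j) * sharp2 α (∑ j ∈ Finset.range 4, a j • r j) := by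
    intro j hj
    have h1 : ((r j)ᴴ * ((∑ k ∈ Finset.range 4, a k • r k) * A1 α)).trace = a j := by
      have : ∀ k ∈ Finset.range 4, ((r j)ᴴ * (a k • r k) * A1 α).trace =
          if j = k then a k else 0 := by
        intro k hk
        have := hr j hj k (Finset.mem_range.mp hk)
        rw [rho1] at this
        rw [Matrix.mul_smul, Matrix.smul_mul, Matrix.trace_smul, this]
        split_ifs <;> simp
      rw [← mul_assoc, Finset.mul_sum, Finset.sum_mul, Matrix.trace_sum, Finset.sum_congr rfl this]
      simp [hj]
    have h2 := norm_trace_mul_le (r j)ᴴ ((∑ k ∈ Finset.range 4, a k • r k) * A1 α)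
    rw [h1, opNorm_conjTranspose] at h2
    exact h2
  have hexp : (∑ j ∈ Finset.range (m + 1), a j • r j) * A1 α =
      ∑ j ∈ Finset.range (m + 1), a j • (r j * A1 α) := by
    rw [Finset.sum_mul]
    exact Finset.sum_congr rfl fun j _ => Matrix.smul_mul _ _ _
  have h0 : ∀ y, 0 ≤ sharp2 α y := fun y => schatten_one_nonneg _
  calc sharp2 α (∑ j ∈ Finset.range (m + 1), a j • r j)
      ≤ ∑ j ∈ Finset.range (m + 1), ‖a j‖ * sharp2 α (r j) := by
        unfold sharp2
        rw [hexp]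
        exact schatten_one_sum_le _ _ _
    _ ≤ ∑ j ∈ Finset.range 4, ‖a j‖ * sharp2 α (r j) := by
        refine Finset.sum_le_sum_of_subset_of_nonneg ?_ fun j _ _ =>
          mul_nonneg (norm_nonneg _) (h0 _)
        intro j hj
        simp only [Finset.mem_range] at *
        omega
    _ ≤ ∑ j ∈ Finset.range 4, (opNorm (r j) * sharp2 α (r j)) *
          sharp2 α (∑ j ∈ Finset.range 4, a j • r j) := by
        refine Finset.sum_le_sum fun j hj => ?_
        have := mul_le_mul_of_nonneg_right (hcoef j (Finset.mem_range.mp hj)) (h0 (r j))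
        linarith
    _ = _ := by rw [Finset.sum_mul]

end
end

section
/- Let r_0, r_1, r_2, r_3 ∈ M_2(ℂ) satisfy ρ_1(r_j* r_k) = δ_{jk}. Then for every ν ≥ 1 and all complex scalars α_0, …, α_{4^{ν+1}−1}, ‖Σ_{j=0}^{4^ν−1} α_j h^{(ν)}_j‖_♯ ≤ ‖r_0‖ · ‖Σ_{j=0}^{4^{ν+1}−1} α_j h^{(ν+1)}_j‖_♯, where the left norm is computed in N_ν on the left side and in N_{ν+1} on the right side. -/
open Finset
open scoped ENNReal ComplexOrder Kronecker Matrix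

noncomputable section

section HelperNorm
open scoped Matrix.Norms.L2Operator

lemma hx_opNorm_eq {N : ℕ} (x : Matrix (Fin N) (Fin N) ℂ) : opNorm x = ‖x‖ := rfl

lemma hx_contr {N : ℕ} (Q : Matrix (Fin N) (Fin N) ℂ) (d : Fin N → ℂ)
    (h : Qᴴ * Q = Matrix.diagonal d) (hd : ∀ i, ‖d i‖ ≤ 1) : ‖Q‖ ≤ 1 := by
  have h1 : ‖Q‖ * ‖Q‖ ≤ 1 := by
    rw [← Matrix.l2_opNorm_conjTranspose_mul_self, h, Matrix.l2_opNorm_diagonal]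
    exact (pi_norm_le_iff_of_nonneg zero_le_one).2 hd
  nlinarith [norm_nonneg Q]

lemma hx_entry {N : ℕ} (M : Matrix (Fin N) (Fin N) ℂ) (i : Fin N) : ‖M i i‖ ≤ ‖M‖ := by
  have h := Matrix.l2_opNorm_mulVec M (EuclideanSpace.single i (1 : ℂ))
  have h2 := PiLp.norm_apply_le ((EuclideanSpace.equiv (Fin N) ℂ).symm <|
    M *ᵥ (EuclideanSpace.single i (1 : ℂ))) i
  have h3 := h2.trans h
  simpa using h3

lemma hx_schatten {N : ℕ} (W : Matrix (Fin N) (Fin N) ℂ) : schatten 1 W =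
    ∑ i, √((Matrix.posSemidef_conjTranspose_mul_self W).isHermitian.eigenvalues i) := by
  simp [schatten, Real.sqrt_eq_rpow]

lemma hx_polar {N : ℕ} (W : Matrix (Fin N) (Fin N) ℂ) :
    ∃ (V Q : Matrix (Fin N) (Fin N) ℂ) (s : Fin N → ℝ), Vᴴ * V = 1 ∧ V * Vᴴ = 1 ∧ ‖Q‖ ≤ 1 ∧
      W * V = Q * Matrix.diagonal (fun i => (s i : ℂ)) ∧
      Qᴴ * (W * V) = Matrix.diagonal (fun i => (s i : ℂ)) ∧ (∀ i, 0 ≤ s i) ∧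
      schatten 1 W = ∑ i, s i := by
  have hP := Matrix.posSemidef_conjTranspose_mul_self W
  set hH := hP.isHermitian with hHdef
  have hl : ∀ i, 0 ≤ hH.eigenvalues i := hP.eigenvalues_nonneg
  set l := hH.eigenvalues with hldef
  set V : Matrix (Fin N) (Fin N) ℂ := (hH.eigenvectorUnitary : Matrix (Fin N) (Fin N) ℂ) with hV
  have hV1 : Vᴴ * V = 1 := Unitary.coe_star_mul_self hH.eigenvectorUnitary
  have hV2 : V * Vᴴ = 1 := Unitary.coe_mul_star_self hH.eigenvectorUnitary
  have hD : (W * V)ᴴ * (W * V) = Matrix.diagonal (fun i => (l i : ℂ)) := by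
    have := hH.conjStarAlgAut_star_eigenvectorUnitary
    rw [Unitary.conjStarAlgAut_star_apply] at this
    rw [Matrix.conjTranspose_mul]
    simp only [Matrix.mul_assoc] at this ⊢
    exact this
  set B := W * V with hB
  have hss : ∀ i, (√(l i) : ℂ) * (√(l i) : ℂ) = (l i : ℂ) := fun i => by
    rw [← Complex.ofReal_mul, Real.mul_self_sqrt (hl i)]
  have hstar : (Matrix.diagonal (fun i => ((√(l i))⁻¹ : ℂ)))ᴴ =
      Matrix.diagonal (fun i => ((√(l i))⁻¹ : ℂ)) := by
    rw [Matrix.diagonal_conjTranspose]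
    congr 1; ext i; simp
  refine ⟨V, B * Matrix.diagonal (fun i => ((√(l i))⁻¹ : ℂ)), fun i => √(l i),
    hV1, hV2, ?_, ?_, ?_, fun i => Real.sqrt_nonneg _, hx_schatten W⟩
  · refine hx_contr _ (fun i => ((√(l i))⁻¹ : ℂ) * ((l i : ℂ) * ((√(l i))⁻¹ : ℂ))) ?_ ?_
    · rw [Matrix.conjTranspose_mul, hstar, Matrix.mul_assoc, ← Matrix.mul_assoc Bᴴ, hD,
        Matrix.diagonal_mul_diagonal, Matrix.diagonal_mul_diagonal]
    · intro i
      rw [← hss i]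
      by_cases h : (√(l i) : ℂ) = 0
      · simp [h]
      · rw [mul_assoc, mul_inv_cancel₀ h, mul_one, inv_mul_cancel₀ h]; simp
  · rw [Matrix.mul_assoc, Matrix.diagonal_mul_diagonal]
    rw [← sub_eq_zero, ← Matrix.conjTranspose_mul_self_eq_zero]
    set E := Matrix.diagonal (fun i => (1 : ℂ) - ((√(l i))⁻¹ : ℂ) * (√(l i) : ℂ)) with hE
    have h1 : B - B * Matrix.diagonal (fun i => ((√(l i))⁻¹ : ℂ) * (√(l i) : ℂ)) = B * E := by
      rw [hE, ← Matrix.diagonal_sub, Matrix.mul_sub, Matrix.diagonal_one, Matrix.mul_one]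
    rw [h1, Matrix.conjTranspose_mul, Matrix.mul_assoc, ← Matrix.mul_assoc Bᴴ, hD, hE,
      Matrix.diagonal_mul_diagonal]
    have h0 : (fun i => (l i : ℂ) * ((1 : ℂ) - ((√(l i))⁻¹ : ℂ) * (√(l i) : ℂ))) = 0 := by
      ext i
      rw [← hss i]
      by_cases h : (√(l i) : ℂ) = 0
      · simp [h]
      · simp [inv_mul_cancel₀ h]
    rw [h0]; simp
  · rw [Matrix.conjTranspose_mul, hstar, Matrix.mul_assoc, hD, Matrix.diagonal_mul_diagonal]
    congr 1; ext i
    rw [← hss i]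
    by_cases h : (√(l i) : ℂ) = 0
    · simp [h]
    · rw [← mul_assoc, inv_mul_cancel₀ h, one_mul]

lemma hx_norm_iso {N : ℕ} (V : Matrix (Fin N) (Fin N) ℂ) (h : Vᴴ * V = 1) : ‖V‖ ≤ 1 :=
  hx_contr V (fun _ => 1) (by rw [h, Matrix.diagonal_one]) (by simp)

lemma hx_dual_le {N : ℕ} (K W : Matrix (Fin N) (Fin N) ℂ) :
    ‖(K * W).trace‖ ≤ ‖K‖ * schatten 1 W := by
  obtain ⟨V, Q, s, h1, h2, hQ, hW, -, hs, hsch⟩ := hx_polar W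
  have e : (K * W).trace = (Vᴴ * K * Q * Matrix.diagonal (fun i => (s i : ℂ))).trace := by
    rw [Matrix.mul_assoc (Vᴴ * K), ← hW, Matrix.mul_assoc, Matrix.trace_mul_comm Vᴴ,
      Matrix.mul_assoc, Matrix.mul_assoc, h2, Matrix.mul_one]
  have hM : ‖Vᴴ * K * Q‖ ≤ ‖K‖ := by
    have hv : ‖Vᴴ‖ ≤ 1 := by
      rw [Matrix.l2_opNorm_conjTranspose]; exact hx_norm_iso V h1
    calc ‖Vᴴ * K * Q‖ ≤ ‖Vᴴ‖ * ‖K‖ * ‖Q‖ :=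
          (norm_mul_le _ _).trans (by gcongr; exact norm_mul_le _ _)
      _ ≤ 1 * ‖K‖ * 1 := by gcongr
      _ = ‖K‖ := by ring
  rw [e, hsch, Matrix.trace, Finset.mul_sum]
  refine (norm_sum_le _ _).trans (Finset.sum_le_sum fun i _ => ?_)
  rw [Matrix.diag_apply, Matrix.mul_diagonal, norm_mul, Complex.norm_real, Real.norm_eq_abs,
    abs_of_nonneg (hs i)]
  exact mul_le_mul_of_nonneg_right ((hx_entry _ i).trans hM) (hs i)

lemma hx_dual_ex {N : ℕ} (W : Matrix (Fin N) (Fin N) ℂ) :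
    ∃ U : Matrix (Fin N) (Fin N) ℂ, ‖U‖ ≤ 1 ∧ ((schatten 1 W : ℝ) : ℂ) = (U * W).trace := by
  obtain ⟨V, Q, s, h1, h2, hQ, -, hW, hs, hsch⟩ := hx_polar W
  refine ⟨V * Qᴴ, ?_, ?_⟩
  · calc ‖V * Qᴴ‖ ≤ ‖V‖ * ‖Qᴴ‖ := norm_mul_le _ _
      _ ≤ 1 * 1 := by
        rw [Matrix.l2_opNorm_conjTranspose]
        gcongr
        exact hx_norm_iso V h1
      _ = 1 := one_mul 1
  · rw [Matrix.mul_assoc, Matrix.trace_mul_comm, Matrix.mul_assoc, hW, Matrix.trace_diagonal, hsch]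
    push_cast; rfl

lemma hx_kron_mul {m n : ℕ} (x x' : Matrix (Fin m) (Fin m) ℂ) (y y' : Matrix (Fin n) (Fin n) ℂ) :
    kron x y * kron x' y' = kron (x * x') (y * y') := by
  simp only [kron, Matrix.reindex_apply, Matrix.submatrix_mul_equiv, Matrix.mul_kronecker_mul]

lemma hx_kron_trace {m n : ℕ} (x : Matrix (Fin m) (Fin m) ℂ) (y : Matrix (Fin n) (Fin n) ℂ) :
    (kron x y).trace = x.trace * y.trace := by
  rw [← Matrix.trace_kronecker]
  simp only [kron, Matrix.trace, Matrix.diag_apply, Matrix.reindex_apply, Matrix.submatrix_apply]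
  exact Equiv.sum_comp (finProdFinEquiv (m := m) (n := n)).symm (fun p => (x ⊗ₖ y) p p)

lemma hx_kron_star {m n : ℕ} (x : Matrix (Fin m) (Fin m) ℂ) (y : Matrix (Fin n) (Fin n) ℂ) :
    (kron x y)ᴴ = kron xᴴ yᴴ := by
  simp only [kron, Matrix.reindex_apply, Matrix.conjTranspose_submatrix,
    Matrix.conjTranspose_kronecker]

/-- `x ↦ x ⊗ 1` as a star homomorphism. -/
def hxLeft (m n : ℕ) : Matrix (Fin m) (Fin m) ℂ →⋆ₙₐ[ℂ] Matrix (Fin (m * n)) (Fin (m * n)) ℂ where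
  toFun x := kron x 1
  map_smul' c x := by ext i j; simp [kron, mul_assoc]
  map_zero' := by simp [kron]
  map_add' x y := by ext i j; simp [kron, add_mul]
  map_mul' x y := by rw [hx_kron_mul, one_mul]
  map_star' x := by
    simp only [Matrix.star_eq_conjTranspose]
    rw [hx_kron_star, Matrix.conjTranspose_one]

/-- `y ↦ 1 ⊗ y` as a star homomorphism. -/
def hxRight (m n : ℕ) : Matrix (Fin n) (Fin n) ℂ →⋆ₙₐ[ℂ] Matrix (Fin (m * n)) (Fin (m * n)) ℂ where
  toFun y := kron 1 y
  map_smul' c x := by ext i j; simp [kron, mul_left_comm]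
  map_zero' := by simp [kron]
  map_add' x y := by ext i j; simp [kron, mul_add]
  map_mul' x y := by rw [hx_kron_mul, one_mul]
  map_star' x := by
    simp only [Matrix.star_eq_conjTranspose]
    rw [hx_kron_star, Matrix.conjTranspose_one]

lemma hx_kron_norm {m n : ℕ} (x : Matrix (Fin m) (Fin m) ℂ) (y : Matrix (Fin n) (Fin n) ℂ) :
    ‖kron x y‖ ≤ ‖x‖ * ‖y‖ := by
  have e : kron x y = kron x 1 * kron 1 y := by rw [hx_kron_mul, mul_one, one_mul]
  rw [e]
  refine (norm_mul_le _ _).trans ?_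
  have h1 : ‖kron x (1 : Matrix (Fin n) (Fin n) ℂ)‖ ≤ ‖x‖ :=
    NonUnitalStarAlgHom.norm_apply_le (hxLeft m n) x
  have h2 : ‖kron (1 : Matrix (Fin m) (Fin m) ℂ) y‖ ≤ ‖y‖ :=
    NonUnitalStarAlgHom.norm_apply_le (hxRight m n) y
  gcongr

lemma hx_schatten_nonneg {N : ℕ} (W : Matrix (Fin N) (Fin N) ℂ) : 0 ≤ schatten 1 W := by
  rw [hx_schatten]
  exact Finset.sum_nonneg fun i _ => Real.sqrt_nonneg _

lemma hx_term (α : ℝ) {ν : ℕ} (U X : Matrix (Fin (2 ^ ν)) (Fin (2 ^ ν)) ℂ)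
    (x y : Matrix (Fin 2) (Fin 2) ℂ) :
    (kron U xᴴ * (kron X y * kron (Amat α ν) (A1 α))).trace =
      (U * (X * Amat α ν)).trace * rho1 α (xᴴ * y) := by
  rw [hx_kron_mul, hx_kron_mul, hx_kron_trace, rho1, Matrix.mul_assoc xᴴ]

lemma hx_haar_low (r : ℕ → Matrix (Fin 2) (Fin 2) ℂ) (ν : ℕ) (hν : 1 ≤ ν) (j : ℕ)
    (hj : j < 4 ^ ν) : haar r (ν + 1) j = kron (haar r ν j) (r 0) := by
  obtain ⟨n, rfl⟩ : ∃ n, ν = n + 1 := ⟨ν - 1, by omega⟩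
  exact if_pos (Nat.div_eq_of_lt hj)

lemma hx_haar_high (r : ℕ → Matrix (Fin 2) (Fin 2) ℂ) (ν : ℕ) (hν : 1 ≤ ν) (j : ℕ)
    (hj : 4 ^ ν ≤ j) (hj2 : j < 4 ^ (ν + 1)) :
    ∃ X q, 0 < q ∧ q < 4 ∧ haar r (ν + 1) j = kron X (r q) := by
  obtain ⟨n, rfl⟩ : ∃ n, ν = n + 1 := ⟨ν - 1, by omega⟩
  have h0 : 0 < j / 4 ^ (n + 1) := Nat.div_pos hj (by positivity)
  have h4 : j / 4 ^ (n + 1) < 4 := Nat.div_lt_of_lt_mul (by rwa [← pow_succ])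
  refine ⟨eUnit (2 ^ (n + 1)) (j % 4 ^ (n + 1)), j / 4 ^ (n + 1) % 4, by rw [Nat.mod_eq_of_lt h4]; exact h0,
    Nat.mod_lt _ (by norm_num), ?_⟩
  exact if_neg h0.ne'

lemma hx_main
    (α : ℝ) (r : ℕ → Matrix (Fin 2) (Fin 2) ℂ)
    (hr : ∀ j < 4, ∀ k < 4, rho1 α ((r j)ᴴ * r k) = if j = k then 1 else 0)
    (ν : ℕ) (hν : 1 ≤ ν) (a : ℕ → ℂ) :
    sharpNorm α (∑ j ∈ Finset.range (4 ^ ν), a j • haar r ν j) ≤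
      opNorm (r 0) *
        sharpNorm α (∑ j ∈ Finset.range (4 ^ (ν + 1)), a j • haar r (ν + 1) j) := by
  set X := ∑ j ∈ Finset.range (4 ^ ν), a j • haar r ν j with hX
  set Y := ∑ j ∈ Finset.range (4 ^ (ν + 1)), a j • haar r (ν + 1) j with hY
  obtain ⟨U, hU, hUX⟩ := hx_dual_ex (X * Amat α ν)
  let K : Matrix (Fin (2 ^ (ν + 1))) (Fin (2 ^ (ν + 1))) ℂ := kron U (r 0)ᴴ
  have key : (U * (X * Amat α ν)).trace = (K * (Y * Amat α (ν + 1))).trace := by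
    rw [hX, hY]
    simp only [Finset.sum_mul, Finset.mul_sum, Matrix.trace_sum, Matrix.smul_mul, Matrix.mul_smul,
      Matrix.trace_smul]
    rw [← Finset.sum_subset (Finset.range_mono (Nat.pow_le_pow_right (by norm_num) (Nat.le_succ ν)))]
    · refine Finset.sum_congr rfl fun j hj => ?_
      rw [hx_haar_low r ν hν j (Finset.mem_range.1 hj)]
      have h := hx_term α U (haar r ν j) (r 0) (r 0)
      rw [hr 0 (by norm_num) 0 (by norm_num), if_pos rfl, mul_one] at h
      exact congrArg (a j • ·) h.symm
    · intro j hj hj'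
      obtain ⟨Z, q, hq0, hq4, e⟩ := hx_haar_high r ν hν j
        (by simpa using hj') (Finset.mem_range.1 hj)
      rw [e]
      have h := hx_term α U Z (r 0) (r q)
      rw [hr 0 (by norm_num) q hq4, if_neg hq0.ne, mul_zero] at h
      exact (congrArg (a j • ·) h).trans (smul_zero _)
  have hK : ‖K‖ ≤ ‖r 0‖ := by
    refine (hx_kron_norm U (r 0)ᴴ).trans ?_
    rw [Matrix.l2_opNorm_conjTranspose]
    exact mul_le_of_le_one_left (norm_nonneg _) hU
  rw [hx_opNorm_eq]
  unfold sharpNorm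
  calc schatten 1 (X * Amat α ν) ≤ ‖((schatten 1 (X * Amat α ν) : ℝ) : ℂ)‖ := by
        rw [Complex.norm_real]; exact le_abs_self _
    _ = ‖(K * (Y * Amat α (ν + 1))).trace‖ := by rw [hUX, key]
    _ ≤ ‖K‖ * schatten 1 (Y * Amat α (ν + 1)) := hx_dual_le _ _
    _ ≤ _ := mul_le_mul_of_nonneg_right hK (hx_schatten_nonneg _)

end HelperNorm

/-- `‖Σ_{j<4^ν} α_j h^{(ν)}_j‖_♯ ≤ ‖r_0‖ · ‖Σ_{j<4^{ν+1}} α_j h^{(ν+1)}_j‖_♯`. -/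
theorem haar_embedding_estimate_sharp
    (α : ℝ) (hα0 : 0 < α) (hα : α ≤ 1 / 2)
    (r : ℕ → Matrix (Fin 2) (Fin 2) ℂ)
    (hr : ∀ j < 4, ∀ k < 4, rho1 α ((r j)ᴴ * r k) = if j = k then 1 else 0)
    (ν : ℕ) (hν : 1 ≤ ν) (a : ℕ → ℂ) :
    sharpNorm α (∑ j ∈ Finset.range (4 ^ ν), a j • haar r ν j) ≤
      opNorm (r 0) *
        sharpNorm α (∑ j ∈ Finset.range (4 ^ (ν + 1)), a j • haar r (ν + 1) j) := by
  exact hx_main α r hr ν hν a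

end
end
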